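/- For all α, z ∈ ℂ \ {0}, the following limits hold: (1) lim_{n→+∞} (−1)^n α^{n} q^{−n(n+1)/2} f_n(z) = 1; (2) lim_{n→+∞} (−1)^n α^{−n} q^{n(n−1)/2} g_n(z) = θ_q(1/(α z)); (3) if moreover 0 < |z| < 1, then lim_{n→−∞} z^{−n} f_n(z) = θ_q(α z) / (z²;q)_∞; (4) lim_{n→−∞} z^{n} g_n(z) = (q z²;q)_∞. -/

import Mathlib

open Complex Filter Topology

/-- Finite q-Pochhammer symbol `(a;q)_n`. -/
noncomputable def qp (q a : ℂ) (n : ℕ) : ℂ := ∏ k ∈ Finset.range n, (1 - a * q ^ k)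

/-- Infinite q-Pochhammer symbol `(a;q)_∞`. -/
noncomputable def qpInf (q a : ℂ) : ℂ := ∏' k : ℕ, (1 - a * q ^ k)

/-- Theta function `θ_q(x) = (x;q)_∞ (q/x;q)_∞`. -/
noncomputable def theta (q x : ℂ) : ℂ := qpInf q x * qpInf q (q / x)

/-- Regularized confluent basic hypergeometric series `₁φ̃₁(0;b;q,w)`. -/
noncomputable def phiT (q b w : ℂ) : ℂ :=
  ∑' k : ℕ, qpInf q (b * q ^ k) * (-1) ^ k * q ^ (k * (k - 1) / 2) * w ^ k / qp q q k

/-- The solution `f_n(z)`. -/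
noncomputable def fseq (q α z : ℂ) (n : ℤ) : ℂ :=
  (-1) ^ n * α ^ (-n) * q ^ (n * (n + 1) / 2) *
    phiT q (q ^ (n + 1) / (α * z)) (z * q ^ (n + 1) / α)

/-- The solution `g_n(z)`. -/
noncomputable def gseq (q α z : ℂ) (n : ℤ) : ℂ :=
  z ^ (-n) * phiT q (α * z * q ^ (1 - n)) (q * z ^ 2)

section QSeries

variable {q : ℂ}

lemma multipliable_one_sub_mul_pow (hq : ‖q‖ < 1) (a : ℂ) :
    Multipliable fun k : ℕ => 1 - a * q ^ k := by
  simpa [sub_eq_add_neg] using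
    Complex.multipliable_one_add_of_summable ((summable_geometric_of_norm_lt_one hq).mul_left a).neg

lemma tendsto_qp (hq : ‖q‖ < 1) (a : ℂ) : Tendsto (qp q a) atTop (𝓝 (qpInf q a)) :=
  (multipliable_one_sub_mul_pow hq a).tendsto_prod_tprod_nat

lemma qp_zero (q a : ℂ) : qp q a 0 = 1 := Finset.prod_range_zero _

lemma qp_succ (q a : ℂ) (n : ℕ) : qp q a (n + 1) = qp q a n * (1 - a * q ^ n) :=
  Finset.prod_range_succ _ _

lemma qp_succ' (q a : ℂ) (n : ℕ) : qp q a (n + 1) = (1 - a) * qp q (a * q) n := by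
  simp only [qp, Finset.prod_range_succ', pow_zero, mul_one]
  rw [mul_comm]
  congr 1
  exact Finset.prod_congr rfl fun k _ => by ring

lemma qpInf_eq_one_sub_mul (hq : ‖q‖ < 1) (a : ℂ) :
    qpInf q a = (1 - a) * qpInf q (a * q) := by
  refine tendsto_nhds_unique ((tendsto_qp hq a).comp (tendsto_add_atTop_nat 1)) ?_
  refine ((tendsto_qp hq (a * q)).const_mul (1 - a)).congr fun n => ?_
  rw [Function.comp_apply, qp_succ']

lemma norm_qpInf_sub_one_le (hq : ‖q‖ < 1) (a : ℂ) :
    ‖qpInf q a - 1‖ ≤ Real.exp (‖a‖ * (1 - ‖q‖)⁻¹) - 1 := by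
  refine le_of_tendsto ((tendsto_qp hq a).sub_const 1).norm (.of_forall fun n => ?_)
  have h := Finset.norm_prod_one_add_sub_one_le (Finset.range n) fun k => -(a * q ^ k)
  simp only [← sub_eq_add_neg, norm_neg, norm_mul, norm_pow, ← Finset.mul_sum] at h
  refine h.trans ?_
  gcongr
  rw [← tsum_geometric_of_lt_one (norm_nonneg q) hq]
  exact (summable_geometric_of_lt_one (norm_nonneg q) hq).sum_le_tsum _ fun k _ => by positivity

lemma norm_qpInf_le (hq : ‖q‖ < 1) {a : ℂ} {R : ℝ} (ha : ‖a‖ ≤ R) :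
    ‖qpInf q a‖ ≤ Real.exp (R * (1 - ‖q‖)⁻¹) := by
  have h := norm_qpInf_sub_one_le hq a
  have h' : ‖qpInf q a‖ ≤ ‖qpInf q a - 1‖ + 1 := by
    simpa using norm_add_le (qpInf q a - 1) 1
  have : 0 ≤ (1 - ‖q‖)⁻¹ := inv_nonneg.2 (by linarith)
  have : Real.exp (‖a‖ * (1 - ‖q‖)⁻¹) ≤ Real.exp (R * (1 - ‖q‖)⁻¹) := by gcongr
  linarith

lemma tendsto_qpInf_zero (hq : ‖q‖ < 1) : Tendsto (qpInf q) (𝓝 0) (𝓝 1) := by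
  rw [tendsto_iff_norm_sub_tendsto_zero]
  refine squeeze_zero (fun _ => norm_nonneg _) (norm_qpInf_sub_one_le hq) ?_
  have : Continuous fun a : ℂ => Real.exp (‖a‖ * (1 - ‖q‖)⁻¹) - 1 := by fun_prop
  simpa using this.tendsto 0

lemma qpInf_zero (q : ℂ) : qpInf q 0 = 1 := by simp [qpInf]

lemma one_sub_pow_succ_ne_zero (hq : ‖q‖ < 1) (k : ℕ) : 1 - q ^ (k + 1) ≠ 0 := by
  intro h
  have h1 : ‖q ^ (k + 1)‖ = 1 := by rw [← sub_eq_zero.1 h, norm_one]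
  rw [norm_pow] at h1
  exact (pow_lt_one₀ (norm_nonneg q) hq k.succ_ne_zero).ne h1

lemma qp_self_succ (q : ℂ) (k : ℕ) : qp q q (k + 1) = qp q q k * (1 - q ^ (k + 1)) := by
  rw [qp_succ, pow_succ']

lemma qp_self_ne_zero (hq : ‖q‖ < 1) (k : ℕ) : qp q q k ≠ 0 := by
  induction k with
  | zero => simp [qp_zero]
  | succ k ih => rw [qp_self_succ]; exact mul_ne_zero ih (one_sub_pow_succ_ne_zero hq k)

lemma tendsto_one_sub_pow_succ (hq : ‖q‖ < 1) :
    Tendsto (fun k : ℕ => 1 - q ^ (k + 1)) atTop (𝓝 1) := by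
  simpa using ((tendsto_pow_atTop_nhds_zero_of_norm_lt_one hq).comp
    (tendsto_add_atTop_nat 1)).const_sub 1

/-- Ratio test for power series whose coefficients satisfy a `q`-hypergeometric recurrence. -/
lemma summable_norm_mul_pow_of_recurrence {c t : ℕ → ℂ} (hc : ∀ k, c k ≠ 0)
    (hrec : ∀ k, c (k + 1) = t k * c k) {s : ℂ} (ht : Tendsto t atTop (𝓝 s)) {r : ℝ}
    (hr : 0 < r) (hsr : ‖s‖ * r < 1) : Summable fun k => ‖c k‖ * r ^ k := by
  refine summable_of_ratio_test_tendsto_lt_one hsr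
    (.of_forall fun k => mul_ne_zero (norm_ne_zero_iff.2 (hc k)) (pow_ne_zero _ hr.ne')) ?_
  refine (ht.norm.mul_const r).congr fun k => ?_
  have := norm_ne_zero_iff.2 (hc k)
  simp only [hrec, norm_mul, norm_norm, norm_pow, Real.norm_of_nonneg hr.le, pow_succ]
  field_simp

lemma tendsto_tsum_mul_pow {ι : Type*} {l : Filter ι} {c : ℕ → ℂ} {r : ℝ}
    (hc : Summable fun k => ‖c k‖ * r ^ k) {D : ι → ℕ → ℂ} {d : ℕ → ℂ} {C : ℝ}
    (hD : ∀ᶠ i in l, ∀ k, ‖D i k‖ ≤ C) (hd : ∀ k, Tendsto (D · k) l (𝓝 (d k)))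
    {u : ι → ℂ} {u₀ : ℂ} (hu : Tendsto u l (𝓝 u₀)) (hur : ‖u₀‖ < r) :
    Tendsto (fun i => ∑' k, D i k * c k * u i ^ k) l (𝓝 (∑' k, d k * c k * u₀ ^ k)) := by
  refine tendsto_tsum_of_dominated_convergence (hc.mul_left C)
    (fun k => ((hd k).mul_const _).mul (hu.pow k)) ?_
  filter_upwards [hD, hu.norm.eventually_lt_const hur] with i hi hui k
  have hC : 0 ≤ C := (norm_nonneg _).trans (hi k)
  rw [norm_mul, norm_mul, norm_pow, mul_assoc]
  have := hi k
  gcongr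

lemma summable_mul_pow {c : ℕ → ℂ} {r : ℝ} (hc : Summable fun k => ‖c k‖ * r ^ k) {u : ℂ}
    (hu : ‖u‖ ≤ r) : Summable fun k => c k * u ^ k := by
  refine Summable.of_norm_bounded hc fun k => ?_
  rw [norm_mul, norm_pow]
  gcongr

lemma tendsto_tsum_mul_pow_zero {c : ℕ → ℂ} {r : ℝ} (hr : 0 < r)
    (hc : Summable fun k => ‖c k‖ * r ^ k) :
    Tendsto (fun u => ∑' k, c k * u ^ k) (𝓝 0) (𝓝 (c 0)) := by
  have h := tendsto_tsum_mul_pow hc (D := fun (_ : ℂ) _ => 1) (C := 1) (l := 𝓝 0)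
    (.of_forall fun _ _ => by simp) (fun _ => tendsto_const_nhds) tendsto_id (by simpa using hr)
  rw [tsum_eq_single 0 fun k hk => by simp [hk]] at h
  simpa using h

lemma summable_inv_qp_self (hq : ‖q‖ < 1) {r : ℝ} (hr : 0 < r) (hr1 : r < 1) :
    Summable fun k => ‖(qp q q k)⁻¹‖ * r ^ k := by
  refine summable_norm_mul_pow_of_recurrence (t := fun k => (1 - q ^ (k + 1))⁻¹) (s := 1⁻¹)
    (fun k => inv_ne_zero (qp_self_ne_zero hq k)) (fun k => ?_)
    ((tendsto_one_sub_pow_succ hq).inv₀ one_ne_zero) hr (by simpa using hr1)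
  rw [qp_self_succ, mul_inv, mul_comm]

/-- Euler's `q`-exponential identity `∑ u^k / (q;q)_k = 1 / (u;q)_∞`. -/
lemma tsum_inv_qp_self_mul_pow (hq : ‖q‖ < 1) {u : ℂ} (hu : ‖u‖ < 1) :
    ∑' k, (qp q q k)⁻¹ * u ^ k = (qpInf q u)⁻¹ := by
  set E : ℂ → ℂ := fun u => ∑' k, (qp q q k)⁻¹ * u ^ k with hE
  have hsum {v : ℂ} (hv : ‖v‖ < 1) : Summable fun k => (qp q q k)⁻¹ * v ^ k := by
    obtain ⟨r, hr, hr1⟩ := exists_between hv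
    exact summable_mul_pow (summable_inv_qp_self hq ((norm_nonneg v).trans_lt hr) hr1) hr.le
  have hlt {v : ℂ} (hv : ‖v‖ < 1) : ‖v * q‖ < 1 := by
    rw [norm_mul]; exact mul_lt_one_of_nonneg_of_lt_one_left (norm_nonneg v) hv hq.le
  have hfun {v : ℂ} (hv : ‖v‖ < 1) : E (v * q) = (1 - v) * E v := by
    have h1 : E v - E (v * q) = ∑' k, (qp q q k)⁻¹ * v ^ k * (1 - q ^ k) := by
      rw [hE, ← (hsum hv).tsum_sub (hsum (hlt hv))]
      exact tsum_congr fun k => by ring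
    have h2 : ∑' k, (qp q q k)⁻¹ * v ^ k * (1 - q ^ k) = v * E v := by
      have hs : Summable fun k => (qp q q k)⁻¹ * v ^ k * (1 - q ^ k) :=
        ((hsum hv).sub (hsum (hlt hv))).congr fun k => by ring
      rw [hs.tsum_eq_zero_add, hE, ← tsum_mul_left]
      simp only [pow_zero, sub_self, mul_zero, zero_add]
      refine tsum_congr fun k => ?_
      have := qp_self_ne_zero hq k
      have := one_sub_pow_succ_ne_zero hq k
      rw [qp_self_succ, pow_succ v]
      field_simp
    linear_combination -h1 - h2
  have hiter (n : ℕ) : E (u * q ^ n) = qp q u n * E u := by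
    induction n with
    | zero => simp [qp_zero]
    | succ n ih =>
      have hn : ‖u * q ^ n‖ < 1 := by
        rw [norm_mul, norm_pow]
        exact mul_lt_one_of_nonneg_of_lt_one_left (norm_nonneg u) hu
          (pow_le_one₀ (norm_nonneg q) hq.le)
      rw [pow_succ, ← mul_assoc, hfun hn, ih, qp_succ]
      ring
  have hlim : Tendsto (fun n : ℕ => E (u * q ^ n)) atTop (𝓝 1) := by
    have h0 := tendsto_tsum_mul_pow_zero (r := 1 / 2) (by norm_num)
      (summable_inv_qp_self hq (by norm_num) (by norm_num))
    have h1 : Tendsto (fun n : ℕ => u * q ^ n) atTop (𝓝 0) := by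
      simpa using (tendsto_pow_atTop_nhds_zero_of_norm_lt_one hq).const_mul u
    rw [qp_zero, inv_one] at h0
    exact h0.comp h1
  refine eq_inv_of_mul_eq_one_right (tendsto_nhds_unique ?_ hlim)
  exact ((tendsto_qp hq u).mul_const (E u)).congr fun n => (hiter n).symm

/-- The coefficients `(-1)^k q^{k(k-1)/2} / (q;q)_k` of Euler's second `q`-exponential. -/
noncomputable def eulerCoeff (q : ℂ) (k : ℕ) : ℂ :=
  (-1) ^ k * q ^ (k * (k - 1) / 2) / qp q q k

lemma eulerCoeff_zero (q : ℂ) : eulerCoeff q 0 = 1 := by simp [eulerCoeff, qp_zero]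

lemma pow_triangle_succ (q : ℂ) (k : ℕ) :
    q ^ ((k + 1) * (k + 1 - 1) / 2) = q ^ (k * (k - 1) / 2) * q ^ k := by
  rw [← pow_add, ← Finset.sum_range_id, ← Finset.sum_range_id, Finset.sum_range_succ]

lemma eulerCoeff_succ (q : ℂ) (k : ℕ) :
    eulerCoeff q (k + 1) = -q ^ k * (1 - q ^ (k + 1))⁻¹ * eulerCoeff q k := by
  rw [eulerCoeff, eulerCoeff, pow_triangle_succ, qp_self_succ, pow_succ]
  simp only [div_eq_mul_inv, mul_inv]
  ring

lemma summable_eulerCoeff (hq : ‖q‖ < 1) (hq0 : q ≠ 0) {r : ℝ} (hr : 0 < r) :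
    Summable fun k => ‖eulerCoeff q k‖ * r ^ k := by
  refine summable_norm_mul_pow_of_recurrence (s := -0 * 1⁻¹)
    (fun k => div_ne_zero (by simp [hq0]) (qp_self_ne_zero hq k)) (eulerCoeff_succ q)
    ((tendsto_pow_atTop_nhds_zero_of_norm_lt_one hq).neg.mul
      ((tendsto_one_sub_pow_succ hq).inv₀ one_ne_zero)) hr (by simp)

/-- Euler's identity `∑ (-1)^k q^{k(k-1)/2} w^k / (q;q)_k = (w;q)_∞`. -/
lemma tsum_eulerCoeff_mul_pow (hq : ‖q‖ < 1) (hq0 : q ≠ 0) (w : ℂ) :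
    ∑' k, eulerCoeff q k * w ^ k = qpInf q w := by
  set G : ℂ → ℂ := fun w => ∑' k, eulerCoeff q k * w ^ k with hG
  have hsum (v : ℂ) : Summable fun k => eulerCoeff q k * v ^ k :=
    summable_mul_pow (summable_eulerCoeff hq hq0 (r := ‖v‖ + 1) (by positivity)) (by linarith)
  have hfun (v : ℂ) : G v = (1 - v) * G (v * q) := by
    have h1 : G v - G (v * q) = ∑' k, eulerCoeff q k * v ^ k * (1 - q ^ k) := by
      rw [hG, ← (hsum v).tsum_sub (hsum (v * q))]
      exact tsum_congr fun k => by ring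
    have h2 : ∑' k, eulerCoeff q k * v ^ k * (1 - q ^ k) = -v * G (v * q) := by
      have hs : Summable fun k => eulerCoeff q k * v ^ k * (1 - q ^ k) :=
        ((hsum v).sub (hsum (v * q))).congr fun k => by ring
      rw [hs.tsum_eq_zero_add, hG, ← tsum_mul_left]
      simp only [pow_zero, sub_self, mul_zero, zero_add]
      refine tsum_congr fun k => ?_
      have := one_sub_pow_succ_ne_zero hq k
      rw [eulerCoeff_succ, mul_pow, pow_succ v]
      field_simp
    linear_combination h1 + h2
  have hiter (n : ℕ) : G w = qp q w n * G (w * q ^ n) := by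
    induction n with
    | zero => simp [qp_zero]
    | succ n ih =>
      rw [ih, hfun (w * q ^ n), qp_succ, pow_succ]
      ring_nf
  have hlim : Tendsto (fun n : ℕ => G (w * q ^ n)) atTop (𝓝 1) := by
    have h0 := tendsto_tsum_mul_pow_zero one_pos (summable_eulerCoeff hq hq0 one_pos)
    have h1 : Tendsto (fun n : ℕ => w * q ^ n) atTop (𝓝 0) := by
      simpa using (tendsto_pow_atTop_nhds_zero_of_norm_lt_one hq).const_mul w
    rw [eulerCoeff_zero] at h0
    exact h0.comp h1
  have h : Tendsto (fun _ : ℕ => G w) atTop (𝓝 (qpInf q w * 1)) :=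
    ((tendsto_qp hq w).mul hlim).congr fun n => (hiter n).symm
  rw [mul_one] at h
  exact tendsto_nhds_unique tendsto_const_nhds h

lemma tendsto_phiT_of_tendsto_zero (hq : ‖q‖ < 1) (hq0 : q ≠ 0) {ι : Type*} {l : Filter ι}
    {b w : ι → ℂ} {w₀ : ℂ} (hb : Tendsto b l (𝓝 0)) (hw : Tendsto w l (𝓝 w₀)) :
    Tendsto (fun i => phiT q (b i) (w i)) l (𝓝 (qpInf q w₀)) := by
  have h := tendsto_tsum_mul_pow (summable_eulerCoeff hq hq0 (r := ‖w₀‖ + 1) (by positivity))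
    (D := fun i k => qpInf q (b i * q ^ k)) (d := fun _ => 1)
    (C := Real.exp (1 * (1 - ‖q‖)⁻¹)) (l := l) ?_ (fun k => ?_) hw (by linarith)
  · simp only [one_mul, tsum_eulerCoeff_mul_pow hq hq0] at h
    refine h.congr fun i => tsum_congr fun k => ?_
    rw [eulerCoeff]
    ring
  · filter_upwards [hb.norm.eventually_le_const (u := 1) (by simp)] with i hi k
    refine norm_qpInf_le hq ?_
    rw [norm_mul, norm_pow]
    exact mul_le_one₀ hi (by positivity) (pow_le_one₀ (norm_nonneg q) hq.le)
  · exact (tendsto_qpInf_zero hq).comp (by simpa using hb.mul_const (q ^ k))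

/-- The quasi-period normalization `(-x)^{-m} q^{m(m-1)/2} (x q^{1-m};q)_∞`, which converges to
`θ_q(1/x)` as `m → ∞`. -/
noncomputable def normalizedQpInf (q x : ℂ) (m : ℤ) : ℂ :=
  (-x) ^ (-m) * q ^ (m * (m - 1) / 2) * qpInf q (x * q ^ (1 - m))

lemma normalizedQpInf_add_one (hq : ‖q‖ < 1) (hq0 : q ≠ 0) {x : ℂ} (hx : x ≠ 0) (m : ℤ) :
    normalizedQpInf q x (m + 1) = (1 - 1 / x * q ^ m) * normalizedQpInf q x m := by
  have hm : (m + 1) * (m + 1 - 1) / 2 = m * (m - 1) / 2 + m := by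
    rw [← Int.add_mul_ediv_right _ _ two_ne_zero]
    ring_nf
  have hx' : -x ≠ 0 := neg_ne_zero.2 hx
  have hqm : q ^ m ≠ 0 := zpow_ne_zero m hq0
  rw [normalizedQpInf, normalizedQpInf, hm, qpInf_eq_one_sub_mul hq,
    show x * q ^ (1 - (m + 1)) * q = x * q ^ (1 - m) by
      rw [mul_assoc, ← zpow_add_one₀ hq0]; ring_nf,
    show 1 - (m + 1) = -m by ring, zpow_add₀ hq0, neg_add, zpow_add₀ hx', zpow_neg q, zpow_neg_one]
  field_simp
  ring

lemma normalizedQpInf_natCast (hq : ‖q‖ < 1) (hq0 : q ≠ 0) {x : ℂ} (hx : x ≠ 0) (n : ℕ) :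
    normalizedQpInf q x n = qp q (1 / x) n * qpInf q (x * q) := by
  induction n with
  | zero => simp [normalizedQpInf, qp_zero]
  | succ n ih =>
    rw [Nat.cast_succ, normalizedQpInf_add_one hq hq0 hx, ih, qp_succ, zpow_natCast]
    ring

lemma tendsto_normalizedQpInf (hq : ‖q‖ < 1) (hq0 : q ≠ 0) {x : ℂ} (hx : x ≠ 0) :
    Tendsto (normalizedQpInf q x) atTop (𝓝 (theta q (1 / x))) := by
  rw [← Nat.map_cast_int_atTop, tendsto_map'_iff]
  rw [theta, show q / (1 / x) = x * q by field_simp]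
  exact ((tendsto_qp hq _).mul_const _).congr fun n => (normalizedQpInf_natCast hq hq0 hx n).symm

lemma tendsto_pow_mul_pow_triangle (hq : ‖q‖ < 1) (hq0 : q ≠ 0) {y : ℂ} (hy : y ≠ 0) :
    Tendsto (fun k : ℕ => y ^ k * q ^ ((k + 1) * (k + 1 - 1) / 2)) atTop (𝓝 0) := by
  have h : Summable fun k : ℕ => ‖y ^ k * q ^ ((k + 1) * (k + 1 - 1) / 2)‖ * 1 ^ k := by
    refine summable_norm_mul_pow_of_recurrence (t := fun k => y * q ^ (k + 1)) (s := y * 0)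
      (fun k => mul_ne_zero (pow_ne_zero _ hy) (pow_ne_zero _ hq0)) (fun k => ?_)
      (((tendsto_pow_atTop_nhds_zero_of_norm_lt_one hq).comp
        (tendsto_add_atTop_nat 1)).const_mul y) one_pos (by simp)
    rw [pow_triangle_succ q (k + 1), pow_succ y]
    ring
  simp only [one_pow, mul_one] at h
  exact h.of_norm.tendsto_atTop_zero

lemma exists_norm_normalizedQpInf_le (hq : ‖q‖ < 1) (hq0 : q ≠ 0) {x : ℂ} (hx : x ≠ 0) :
    ∃ C, ∀ m, ‖normalizedQpInf q x m‖ ≤ C := by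
  have hpos := (tendsto_normalizedQpInf hq hq0 hx).comp tendsto_natCast_atTop_atTop
  obtain ⟨C₁, hC₁⟩ := (Metric.isBounded_range_of_tendsto _ hpos).exists_norm_le
  obtain ⟨C₂, hC₂⟩ := (Metric.isBounded_range_of_tendsto _
    (tendsto_pow_mul_pow_triangle hq hq0 (neg_ne_zero.2 hx))).exists_norm_le
  refine ⟨max C₁ (C₂ * Real.exp (‖x‖ * (1 - ‖q‖)⁻¹)), fun m => ?_⟩
  obtain ⟨n, rfl | rfl⟩ := m.eq_nat_or_neg
  · exact (hC₁ _ ⟨n, rfl⟩).trans (le_max_left _ _)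
  · refine le_trans ?_ (le_max_right _ _)
    have hn : -(n : ℤ) * (-n - 1) / 2 = (((n + 1) * (n + 1 - 1) / 2 : ℕ) : ℤ) := by
      push_cast [Nat.add_sub_cancel]
      ring_nf
    have hC := hC₂ _ ⟨n, rfl⟩
    rw [normalizedQpInf, hn, neg_neg, zpow_natCast, zpow_natCast, norm_mul]
    refine mul_le_mul hC (norm_qpInf_le hq ?_) (norm_nonneg _) ((norm_nonneg _).trans hC)
    rw [norm_mul, sub_neg_eq_add, ← Nat.cast_one, ← Nat.cast_add, zpow_natCast, norm_pow]
    exact mul_le_of_le_one_right (norm_nonneg x) (pow_le_one₀ (norm_nonneg q) hq.le)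

lemma triangle_sub (N : ℤ) (k : ℕ) :
    N * (N - 1) / 2 + ((k * (k - 1) / 2 : ℕ) : ℤ) = (N - k) * (N - k - 1) / 2 + (N - 1) * k := by
  induction k with
  | zero => simp
  | succ k ih =>
    have h1 : (k + 1) * (k + 1 - 1) / 2 = k * (k - 1) / 2 + k := by
      rw [← Finset.sum_range_id, ← Finset.sum_range_id, Finset.sum_range_succ]
    have h2 : (N - k) * (N - k - 1) / 2
        = (N - (k + 1)) * (N - (k + 1) - 1) / 2 + (N - (k + 1)) := by
      rw [← Int.add_mul_ediv_right _ _ two_ne_zero]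
      ring_nf
    rw [h1, Nat.cast_add, Nat.cast_succ]
    linear_combination ih + h2

lemma mul_phiT_eq_tsum (hq0 : q ≠ 0) {x : ℂ} (hx : x ≠ 0) (w : ℂ) (N : ℤ) :
    (-x) ^ (-N) * q ^ (N * (N - 1) / 2) * phiT q (x * q ^ (1 - N)) w =
      ∑' k : ℕ, normalizedQpInf q x (N - k) * (qp q q k)⁻¹ * (w * q ^ (N - 1) / x) ^ k := by
  rw [phiT, ← tsum_mul_left]
  refine tsum_congr fun k => ?_
  have hx' : -x ≠ 0 := neg_ne_zero.2 hx
  have hexp : q ^ (N * (N - 1) / 2) * q ^ (k * (k - 1) / 2)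
      = q ^ ((N - k) * (N - k - 1) / 2) * (q ^ (N - 1)) ^ k := by
    rw [← zpow_natCast q, ← zpow_add₀ hq0, triangle_sub, zpow_add₀ hq0, zpow_mul, zpow_natCast]
  have harg : x * q ^ (1 - N) * q ^ k = x * q ^ (1 - (N - k)) := by
    rw [mul_assoc, ← zpow_natCast q, ← zpow_add₀ hq0]
    ring_nf
  have hpow : (-x) ^ (-(N - k)) = (-x) ^ (-N) * ((-1) ^ k * x ^ k) := by
    rw [neg_sub, sub_eq_neg_add, zpow_add₀ hx', zpow_natCast, ← neg_pow]
  rw [normalizedQpInf, harg, hpow, div_pow, mul_pow]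
  field_simp
  linear_combination w ^ k * qpInf q (x * q ^ (1 - (N - k))) * (qp q q k)⁻¹ * hexp

lemma tendsto_mul_phiT (hq : ‖q‖ < 1) (hq0 : q ≠ 0) {x : ℂ} (hx : x ≠ 0) {w : ℤ → ℂ} {u : ℂ}
    (hw : Tendsto (fun N => w N * q ^ (N - 1) / x) atTop (𝓝 u)) (hu : ‖u‖ < 1) :
    Tendsto (fun N : ℤ => (-x) ^ (-N) * q ^ (N * (N - 1) / 2) * phiT q (x * q ^ (1 - N)) (w N))
      atTop (𝓝 (theta q (1 / x) / qpInf q u)) := by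
  obtain ⟨r, hur, hr1⟩ := exists_between hu
  obtain ⟨C, hC⟩ := exists_norm_normalizedQpInf_le hq hq0 hx
  have h := tendsto_tsum_mul_pow
    (summable_inv_qp_self hq ((norm_nonneg u).trans_lt hur) hr1) (l := atTop)
    (D := fun (N : ℤ) (k : ℕ) => normalizedQpInf q x (N - k)) (d := fun _ => theta q (1 / x))
    (.of_forall fun N k => hC (N - k)) (fun k => (tendsto_normalizedQpInf hq hq0 hx).comp
      (tendsto_atTop_add_const_right _ (-(k : ℤ)) tendsto_id)) hw hur
  simp only [mul_assoc, tsum_mul_left, tsum_inv_qp_self_mul_pow hq hu] at h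
  rw [div_eq_mul_inv]
  refine h.congr fun N => ?_
  rw [mul_phiT_eq_tsum hq0 hx]
  simp only [mul_assoc]

lemma tendsto_zpow_atTop_nhds_zero (hq : ‖q‖ < 1) : Tendsto (fun n : ℤ => q ^ n) atTop (𝓝 0) := by
  rw [← Nat.map_cast_int_atTop, tendsto_map'_iff]
  simpa [Function.comp_def] using tendsto_pow_atTop_nhds_zero_of_norm_lt_one hq

end QSeries

theorem stmt_13 (q : ℝ) (hq0 : 0 < q) (hq1 : q < 1) (α z : ℂ) (hα : α ≠ 0) (hz : z ≠ 0) :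
    Tendsto (fun n : ℤ => (-1) ^ n * α ^ n * (q : ℂ) ^ (-(n * (n + 1) / 2)) * fseq (q : ℂ) α z n)
      atTop (nhds 1) ∧
    Tendsto (fun n : ℤ => (-1) ^ n * α ^ (-n) * (q : ℂ) ^ (n * (n - 1) / 2) * gseq (q : ℂ) α z n)
      atTop (nhds (theta (q : ℂ) (1 / (α * z)))) ∧
    (‖z‖ < 1 →
      Tendsto (fun n : ℤ => z ^ (-n) * fseq (q : ℂ) α z n) atBot
        (nhds (theta (q : ℂ) (α * z) / qpInf (q : ℂ) (z ^ 2)))) ∧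
    Tendsto (fun n : ℤ => z ^ n * gseq (q : ℂ) α z n) atBot
      (nhds (qpInf (q : ℂ) ((q : ℂ) * z ^ 2))) := by
  have hq : ‖(q : ℂ)‖ < 1 := by rwa [Complex.norm_real, Real.norm_of_nonneg hq0.le]
  have hqc : (q : ℂ) ≠ 0 := Complex.ofReal_ne_zero.2 hq0.ne'
  have hαz : α * z ≠ 0 := mul_ne_zero hα hz
  have hzpow (c : ℤ) : Tendsto (fun n : ℤ => (q : ℂ) ^ (n + c)) atTop (𝓝 0) :=
    (tendsto_zpow_atTop_nhds_zero hq).comp (tendsto_atTop_add_const_right _ c tendsto_id)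
  have hsign (n : ℤ) : ((-1 : ℂ) ^ n) * (-1) ^ n = 1 := by
    rw [← mul_zpow]; simp
  refine ⟨?_, ?_, fun hz1 => ?_, ?_⟩
  · have hb : Tendsto (fun n : ℤ => (q : ℂ) ^ (n + 1) / (α * z)) atTop (𝓝 0) := by
      simpa using (hzpow 1).div_const (α * z)
    have hw : Tendsto (fun n : ℤ => z * (q : ℂ) ^ (n + 1) / α) atTop (𝓝 0) := by
      simpa using ((hzpow 1).const_mul z).div_const α
    have h := tendsto_phiT_of_tendsto_zero hq hqc hb hw
    rw [qpInf_zero] at h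
    refine h.congr fun n => ?_
    have hα' := zpow_ne_zero n hα
    have hq' := zpow_ne_zero (n * (n + 1) / 2) hqc
    rw [fseq, zpow_neg, zpow_neg]
    field_simp
    rw [pow_two, hsign, mul_one]
  · have hw : Tendsto (fun N : ℤ => (q * z ^ 2) * (q : ℂ) ^ (N - 1) / (α * z)) atTop (𝓝 0) := by
      simpa [sub_eq_add_neg] using ((hzpow (-1)).const_mul (q * z ^ 2)).div_const (α * z)
    have h := tendsto_mul_phiT hq hqc hαz hw (by simp)
    rw [qpInf_zero, div_one] at h
    refine h.congr fun n => ?_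
    have hs : (-1 : ℂ) ^ (-n) = (-1) ^ n := by
      rw [zpow_neg]; exact inv_eq_of_mul_eq_one_left (hsign n)
    rw [gseq, ← neg_one_mul (α * z), mul_zpow, mul_zpow, hs]
    ring_nf
  · have hx : 1 / (α * z) ≠ 0 := one_div_ne_zero hαz
    have hw : Tendsto (fun N : ℤ => (z * (q : ℂ) ^ (1 - N) / α) * (q : ℂ) ^ (N - 1) /
        (1 / (α * z))) atTop (𝓝 (z ^ 2)) := by
      refine tendsto_const_nhds.congr fun N => ?_
      have hN := zpow_ne_zero (N - 1) hqc
      rw [← neg_sub N 1, zpow_neg]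
      field_simp
    have h := (tendsto_mul_phiT hq hqc hx hw (by
      rw [norm_pow]; exact pow_lt_one₀ (norm_nonneg z) hz1 two_ne_zero)).comp
      tendsto_neg_atBot_atTop
    rw [one_div_one_div] at h
    refine h.congr fun n => ?_
    have hexp : -n * (-n - 1) / 2 = n * (n + 1) / 2 := by ring_nf
    rw [Function.comp_apply, fseq, hexp, neg_neg, sub_neg_eq_add, add_comm 1 n,
      ← neg_one_mul (1 / (α * z)), mul_zpow, one_div, inv_zpow', mul_zpow, div_eq_inv_mul]
    ring_nf
  · have hb : Tendsto (fun n : ℤ => α * z * (q : ℂ) ^ (1 - n)) atBot (𝓝 0) := by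
      have := ((hzpow 1).comp tendsto_neg_atBot_atTop).const_mul (α * z)
      rw [mul_zero] at this
      refine this.congr fun n => ?_
      rw [Function.comp_apply, neg_add_eq_sub]
    refine (tendsto_phiT_of_tendsto_zero hq hqc hb tendsto_const_nhds).congr fun n => ?_
    rw [gseq, ← mul_assoc, ← zpow_add₀ hz, add_neg_cancel, zpow_zero, one_mul]
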